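/- arXiv:1407.1658 — 5 statements merged into one kernel-verified Lean document; each statement's English description precedes it below -/
import Mathlib

section
/- For every x ∈ ℝ² one has ‖σ(x)‖² + 2⟨x, b(x)⟩ ≤ 1, and in particular ‖σ(x)‖² + 2⟨x, b(x)⟩ ≤ |x|² + 1 (the coercivity/growth condition (1.5) of the paper for the example coefficients). -/
open Real

/-- Euclidean norm of a vector in ℝ². -/
noncomputable def nrm (x : Fin 2 → ℝ) : ℝ := Real.sqrt (x 0 ^ 2 + x 1 ^ 2)

/-- Euclidean inner product on ℝ². -/
noncomputable def inn (x y : Fin 2 → ℝ) : ℝ := x 0 * y 0 + x 1 * y 1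

/-- The example diffusion coefficient σ(x). -/
noncomputable def sig (p : ℝ) (x : Fin 2 → ℝ) : Matrix (Fin 2) (Fin 2) ℝ :=
  ![![x 0 / (1 + nrm x), x 1 / (1 + nrm x)],
    ![-((1 + nrm x ^ (p / 2 - 1)) * x 1), (1 + nrm x ^ (p / 2 - 1)) * x 0]]

/-- The example drift coefficient b(x) = -K₀(1+|x|^{p-2})x. -/
noncomputable def bdrift (p K₀ : ℝ) (x : Fin 2 → ℝ) : Fin 2 → ℝ :=
  fun i => -(K₀ * (1 + nrm x ^ (p - 2))) * x i

/-- Squared Hilbert–Schmidt (Frobenius) norm of a 2×2 real matrix. -/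
noncomputable def hsSq (M : Matrix (Fin 2) (Fin 2) ℝ) : ℝ := ∑ i, ∑ j, M i j ^ 2

theorem nrm_nonneg (x : Fin 2 → ℝ) : 0 ≤ nrm x := Real.sqrt_nonneg _

theorem nrm_sq (x : Fin 2 → ℝ) : nrm x ^ 2 = x 0 ^ 2 + x 1 ^ 2 :=
  Real.sq_sqrt (by positivity)

theorem hsSq_sig (p : ℝ) (x : Fin 2 → ℝ) :
    hsSq (sig p x) =
      (nrm x / (1 + nrm x)) ^ 2 + (1 + nrm x ^ (p / 2 - 1)) ^ 2 * nrm x ^ 2 := by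
  rw [div_pow, nrm_sq]
  simp only [hsSq, sig, Fin.sum_univ_two, Matrix.cons_val_zero, Matrix.cons_val_one,
    div_pow]
  ring

theorem inn_bdrift (p K₀ : ℝ) (x : Fin 2 → ℝ) :
    inn x (bdrift p K₀ x) = -(K₀ * (1 + nrm x ^ (p - 2)) * nrm x ^ 2) := by
  rw [nrm_sq]
  simp only [inn, bdrift]
  ring

theorem hsSq_sig_add_inn_bdrift_le_one (p : ℝ) {K₀ : ℝ} (hK₀ : 1 ≤ K₀)
    (x : Fin 2 → ℝ) : hsSq (sig p x) + 2 * inn x (bdrift p K₀ x) ≤ 1 := by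
  have hr := nrm_nonneg x
  have hpow : nrm x ^ (p - 2) = (nrm x ^ (p / 2 - 1)) ^ 2 := by
    rw [← Real.rpow_mul_natCast hr]
    congr 1
    push_cast
    ring
  rw [hsSq_sig, inn_bdrift, hpow]
  set r := nrm x
  set s := r ^ (p / 2 - 1)
  have hquot : (r / (1 + r)) ^ 2 ≤ 1 :=
    pow_le_one₀ (by positivity) (div_le_one_of_le₀ (by linarith) (by positivity))
  have hcoef : (1 + s) ^ 2 ≤ 2 * (K₀ * (1 + s ^ 2)) := by
    nlinarith [sq_nonneg (1 - s), mul_nonneg (sub_nonneg.2 hK₀) (by positivity : 0 ≤ 1 + s ^ 2)]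
  nlinarith [mul_le_mul_of_nonneg_right hcoef (sq_nonneg r)]

/-- Coercivity condition (1.5) for the example coefficients:
‖σ(x)‖² + 2⟨x, b(x)⟩ ≤ 1 ≤ |x|² + 1. -/
theorem stmt0 (p K₀ : ℝ) (hp2 : 2 < p) (hp4 : p < 4) (hK₀ : 4 ≤ K₀)
    (x : Fin 2 → ℝ) :
    hsSq (sig p x) + 2 * inn x (bdrift p K₀ x) ≤ 1 ∧
    hsSq (sig p x) + 2 * inn x (bdrift p K₀ x) ≤ nrm x ^ 2 + 1 := by
  have h := hsSq_sig_add_inn_bdrift_le_one p (by linarith : 1 ≤ K₀) x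
  exact ⟨h, h.trans (le_add_of_nonneg_left (sq_nonneg _))⟩
end

section
/- Fix a real number p with 2 < p < 4. For all real numbers a, b ≥ 0, one has a·b·(a^{p/2−1} − b^{p/2−1})² ≤ (a−b)(a^{p−1} − b^{p−1}). -/
open Real

/-- The inequality `2ab(x² + y²) ≤ (ax + by)²`, in the square roots of `a, b, x, y`. -/
lemma two_mul_mul_sq_add_sq_le {A B X Y : ℝ} (hB : 0 ≤ B) (hY : 0 ≤ Y) (hAB : B ≤ A)
    (hXY : Y ≤ X) (h : B * X ≤ A * Y) :
    2 * (A ^ 2 * B ^ 2) * (X ^ 4 + Y ^ 4) ≤ (A ^ 2 * X ^ 2 + B ^ 2 * Y ^ 2) ^ 2 := by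
  have hA : 0 ≤ A := hB.trans hAB
  have hX : 0 ≤ X := hY.trans hXY
  have hcube : B * Y ^ 3 ≤ A * X ^ 3 := by gcongr
  have hmid : A * B * (X ^ 4 + Y ^ 4) ≤ X * Y * (A ^ 2 * X ^ 2 + B ^ 2 * Y ^ 2) := by
    linarith [mul_nonneg (sub_nonneg.2 h) (sub_nonneg.2 hcube)]
  calc 2 * (A ^ 2 * B ^ 2) * (X ^ 4 + Y ^ 4)
      = 2 * (A * B) * (A * B * (X ^ 4 + Y ^ 4)) := by ring
    _ ≤ 2 * (A * B) * (X * Y * (A ^ 2 * X ^ 2 + B ^ 2 * Y ^ 2)) := by gcongr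
    _ ≤ (A ^ 2 * X ^ 2 + B ^ 2 * Y ^ 2) ^ 2 := by
      have hpos : 0 ≤ A ^ 2 * X ^ 2 + B ^ 2 * Y ^ 2 := by positivity
      linarith [mul_nonneg hpos (sq_nonneg (A * X - B * Y))]

lemma mul_rpow_le_mul_rpow_of_le {a b s : ℝ} (hb : 0 ≤ b) (hab : b ≤ a) (hs0 : 0 ≤ s)
    (hs1 : s ≤ 1) : b * a ^ s ≤ a * b ^ s := by
  have split : ∀ c : ℝ, 0 ≤ c → c = c ^ (1 - s) * c ^ s := fun c hc ↦ by
    rw [← rpow_add_of_nonneg hc (by linarith) hs0, sub_add_cancel, rpow_one]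
  have ha := hb.trans hab
  calc b * a ^ s = b ^ (1 - s) * (b ^ s * a ^ s) := by
        rw [← mul_assoc, ← split b hb]
    _ ≤ a ^ (1 - s) * (b ^ s * a ^ s) := by
        have := rpow_le_rpow hb hab (by linarith : 0 ≤ 1 - s)
        gcongr
    _ = a * b ^ s := by
        rw [mul_comm (b ^ s), ← mul_assoc, ← split a ha]

/-- For 2 < p < 4 and a, b ≥ 0:
ab(a^{p/2−1} − b^{p/2−1})² ≤ (a−b)(a^{p−1} − b^{p−1}). -/
theorem stmt6 (p a b : ℝ) (hp2 : 2 < p) (hp4 : p < 4) (ha : 0 ≤ a) (hb : 0 ≤ b) :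
    a * b * (a ^ (p / 2 - 1) - b ^ (p / 2 - 1)) ^ 2
      ≤ (a - b) * (a ^ (p - 1) - b ^ (p - 1)) := by
  wlog hab : b ≤ a generalizing a b
  · linarith [this b a hb ha (not_le.1 hab).le]
  have hs : 0 ≤ p / 2 - 1 := by linarith
  have split : ∀ c : ℝ, 0 ≤ c → c ^ (p - 1) = c * (c ^ (p / 2 - 1)) ^ 2 := fun c hc ↦ by
    rw [← rpow_mul_natCast hc]
    nth_rw 2 [← rpow_one c]
    rw [← rpow_add_of_nonneg hc zero_le_one (by push_cast; linarith)]
    congr 1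
    push_cast
    ring
  rw [split a ha, split b hb]
  have hxy := rpow_le_rpow hb hab hs
  have hmul := mul_rpow_le_mul_rpow_of_le hb hab hs (by linarith)
  have hx : 0 ≤ a ^ (p / 2 - 1) := rpow_nonneg ha _
  have hy : 0 ≤ b ^ (p / 2 - 1) := rpow_nonneg hb _
  generalize a ^ (p / 2 - 1) = x at *
  generalize b ^ (p / 2 - 1) = y at *
  have key := two_mul_mul_sq_add_sq_le (sqrt_nonneg b) (sqrt_nonneg y) (sqrt_le_sqrt hab)
    (sqrt_le_sqrt hxy) (by rw [← sqrt_mul hb, ← sqrt_mul ha]; exact sqrt_le_sqrt hmul)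
  have hfour : ∀ z : ℝ, 0 ≤ z → √z ^ 4 = z ^ 2 := fun z hz ↦ by
    rw [show √z ^ 4 = (√z ^ 2) ^ 2 by ring, sq_sqrt hz]
  rw [hfour x hx, hfour y hy, sq_sqrt ha, sq_sqrt hb, sq_sqrt hx, sq_sqrt hy] at key
  linarith
end

section
/- For all x, y ∈ ℝ² one has ‖σ(x) − σ(y)‖² + ⟨x−y, b(x)−b(y)⟩ ≤ 3|x−y|² − (K₀−2)(|x|−|y|)(|x|^{p−1} − |y|^{p−1}) + 2|x||y|(|x|^{p/2−1} − |y|^{p/2−1})². -/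
open Real

theorem inn_le_nrm_mul_nrm (x y : Fin 2 → ℝ) : inn x y ≤ nrm x * nrm y := by
  refine abs_le_of_sq_le_sq' ?_ (mul_nonneg (nrm_nonneg x) (nrm_nonneg y)) |>.2
  rw [mul_pow, nrm_sq, nrm_sq, inn]
  nlinarith [sq_nonneg (x 0 * y 1 - x 1 * y 0)]

theorem nrm_sub_sq (x y : Fin 2 → ℝ) :
    nrm (x - y) ^ 2 = (nrm x - nrm y) ^ 2 + 2 * (nrm x * nrm y - inn x y) := by
  have hx := nrm_sq x
  have hy := nrm_sq y
  rw [nrm_sq, inn]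
  simp only [Pi.sub_apply]
  linear_combination -hx - hy

theorem rpow_sub_one_eq {a p : ℝ} (ha : 0 ≤ a) (hp : 2 < p) :
    a ^ (p - 1) = a ^ (p - 2) * a := by
  rw [← Real.rpow_add_one' ha (by linarith)]
  ring_nf

theorem rpow_sub_two_eq_sq {a : ℝ} (ha : 0 ≤ a) (p : ℝ) :
    a ^ (p - 2) = (a ^ (p / 2 - 1)) ^ 2 := by
  rw [← Real.rpow_mul_natCast ha]
  congr 1
  push_cast
  ring

/-- Radial scaling `x ↦ αx`, `y ↦ βy`: the squared distance in terms of the radii and the defect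
in the Cauchy–Schwarz inequality. -/
theorem sq_dist_smul (α β : ℝ) (x y : Fin 2 → ℝ) :
    (α * x 0 - β * y 0) ^ 2 + (α * x 1 - β * y 1) ^ 2 =
      (α * nrm x - β * nrm y) ^ 2 + 2 * α * β * (nrm x * nrm y - inn x y) := by
  rw [inn]
  linear_combination -α ^ 2 * nrm_sq x - β ^ 2 * nrm_sq y

/-- The map `x ↦ x / (1 + |x|)` is nonexpansive. -/
theorem sq_dist_div_one_add_nrm_le (x y : Fin 2 → ℝ) :
    (x 0 / (1 + nrm x) - y 0 / (1 + nrm y)) ^ 2 + (x 1 / (1 + nrm x) - y 1 / (1 + nrm y)) ^ 2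
      ≤ nrm (x - y) ^ 2 := by
  have ha := nrm_nonneg x
  have hb := nrm_nonneg y
  have hs := sub_nonneg.2 (inn_le_nrm_mul_nrm x y)
  have key := sq_dist_smul (1 + nrm x)⁻¹ (1 + nrm y)⁻¹ x y
  simp only [div_eq_inv_mul]
  rw [key, nrm_sub_sq]
  set t := (1 + nrm x)⁻¹ * (1 + nrm y)⁻¹ with ht
  have ht0 : 0 ≤ t := by positivity
  have ht1 : t ≤ 1 := mul_le_one₀ (inv_le_one_of_one_le₀ (by linarith)) (by positivity)
    (inv_le_one_of_one_le₀ (by linarith))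
  have hr : (1 + nrm x)⁻¹ * nrm x - (1 + nrm y)⁻¹ * nrm y = t * (nrm x - nrm y) := by
    rw [ht]
    field_simp
    ring
  rw [hr, mul_pow, mul_assoc 2, ← ht]
  have h1 : t ^ 2 * (nrm x - nrm y) ^ 2 ≤ (nrm x - nrm y) ^ 2 :=
    mul_le_of_le_one_left (sq_nonneg _) (pow_le_one₀ ht0 ht1)
  have h2 : t * (nrm x * nrm y - inn x y) ≤ nrm x * nrm y - inn x y :=
    mul_le_of_le_one_left hs ht1
  linarith

/-- ‖σ(x) − σ(y)‖² + ⟨x−y, b(x)−b(y)⟩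
  ≤ 3|x−y|² − (K₀−2)(|x|−|y|)(|x|^{p−1} − |y|^{p−1}) + 2|x||y|(|x|^{p/2−1} − |y|^{p/2−1})². -/
theorem stmt9 (p K₀ : ℝ) (hp2 : 2 < p) (hp4 : p < 4) (hK₀ : 4 ≤ K₀)
    (x y : Fin 2 → ℝ) :
    hsSq (sig p x - sig p y) + inn (x - y) (bdrift p K₀ x - bdrift p K₀ y)
      ≤ 3 * nrm (x - y) ^ 2
        - (K₀ - 2) * (nrm x - nrm y) * (nrm x ^ (p - 1) - nrm y ^ (p - 1))
        + 2 * nrm x * nrm y * (nrm x ^ (p / 2 - 1) - nrm y ^ (p / 2 - 1)) ^ 2 := by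
  have hs := sub_nonneg.2 (inn_le_nrm_mul_nrm x y)
  have hrow := sq_dist_div_one_add_nrm_le x y
  have hrot := sq_dist_smul (1 + nrm x ^ (p / 2 - 1)) (1 + nrm y ^ (p / 2 - 1)) x y
  have hD := nrm_sub_sq x y
  have hdrift : inn (x - y) (bdrift p K₀ x - bdrift p K₀ y) =
      -K₀ * ((nrm x - nrm y) * ((1 + nrm x ^ (p - 2)) * nrm x - (1 + nrm y ^ (p - 2)) * nrm y)
        + (2 + nrm x ^ (p - 2) + nrm y ^ (p - 2)) * (nrm x * nrm y - inn x y)) := by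
    simp only [inn, bdrift, Pi.sub_apply]
    linear_combination K₀ * (1 + nrm x ^ (p - 2)) * nrm_sq x
      + K₀ * (1 + nrm y ^ (p - 2)) * nrm_sq y
  have hsig : hsSq (sig p x - sig p y) =
      ((x 0 / (1 + nrm x) - y 0 / (1 + nrm y)) ^ 2
        + (x 1 / (1 + nrm x) - y 1 / (1 + nrm y)) ^ 2)
      + (((1 + nrm x ^ (p / 2 - 1)) * x 0 - (1 + nrm y ^ (p / 2 - 1)) * y 0) ^ 2
        + ((1 + nrm x ^ (p / 2 - 1)) * x 1 - (1 + nrm y ^ (p / 2 - 1)) * y 1) ^ 2) := by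
    simp only [hsSq, Fin.sum_univ_two, Matrix.sub_apply]
    simp [sig]
    ring
  rw [hdrift, hsig, hrot, rpow_sub_one_eq (nrm_nonneg x) hp2, rpow_sub_one_eq (nrm_nonneg y) hp2,
    rpow_sub_two_eq_sq (nrm_nonneg x), rpow_sub_two_eq_sq (nrm_nonneg y)]
  rw [hD] at hrow ⊢
  generalize nrm x ^ (p / 2 - 1) = u
  generalize nrm y ^ (p / 2 - 1) = v
  generalize nrm x * nrm y - inn x y = s at *
  generalize nrm x = a at *
  generalize nrm y = b at *
  have hsum : ((1 + u) * a - (1 + v) * b) ^ 2 ≤ 2 * (a - b) ^ 2 + 2 * (u * a - v * b) ^ 2 := by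
    linarith [sq_nonneg ((a - b) - (u * a - v * b))]
  have hcross : 2 * (1 + u) * (1 + v) * s ≤ 2 * ((2 + u ^ 2 + v ^ 2) * s) := by
    rw [← mul_assoc]
    refine mul_le_mul_of_nonneg_right ?_ hs
    linarith [sq_nonneg (u - 1), sq_nonneg (v - 1), sq_nonneg (u - v)]
  have hK : 4 * ((2 + u ^ 2 + v ^ 2) * s) ≤ K₀ * ((2 + u ^ 2 + v ^ 2) * s) := by
    gcongr
  have hKab : 0 ≤ K₀ * (a - b) ^ 2 := by positivity
  have hnn : 0 ≤ (2 + u ^ 2 + v ^ 2) * s := by positivity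
  linarith
end

section
/- The diffusion coefficient σ of the example is not of linear growth: for every real K > 0 there exists x ∈ ℝ² with ‖σ(x)‖² > K(1 + |x|²). -/
open Real

/-- The example diffusion coefficient σ is not of linear growth. -/
theorem stmt11 (p K₀ : ℝ) (hp2 : 2 < p) (hp4 : p < 4) (hK₀ : 4 ≤ K₀)
    (K : ℝ) (hK : 0 < K) :
    ∃ x : Fin 2 → ℝ, K * (1 + nrm x ^ 2) < hsSq (sig p x) := by
  have hlim := tendsto_rpow_atTop (show 0 < p / 2 - 1 by linarith)
  obtain ⟨r, hr1, hrK⟩ :=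
    ((Filter.eventually_ge_atTop (1 : ℝ)).and (hlim.eventually_ge_atTop K)).exists
  have hr : nrm ![r, 0] = r := by
    simp [nrm, Real.sqrt_sq (zero_le_one.trans hr1)]
  refine ⟨![r, 0], ?_⟩
  have hsig : ((1 + r ^ (p / 2 - 1)) * r) ^ 2 ≤ hsSq (sig p ![r, 0]) := by
    simp [hsSq, sig, Fin.sum_univ_two, hr]
    positivity
  rw [hr]
  calc K * (1 + r ^ 2) ≤ 2 * K * r ^ 2 := by nlinarith [one_le_pow₀ hr1 (n := 2)]
    _ < (1 + K) ^ 2 * r ^ 2 := by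
      gcongr
      nlinarith
    _ = ((1 + K) * r) ^ 2 := by ring
    _ ≤ ((1 + r ^ (p / 2 - 1)) * r) ^ 2 := by gcongr
    _ ≤ _ := hsig
end

section
/- The drift coefficient b of the example is not of linear growth: for every real K > 0 there exists x ∈ ℝ² with |b(x)| > K(|x| + 1). -/
open Real

/-- Absolute homogeneity of the Euclidean norm, for a multiple of a vector. -/
lemma nrm_mul (c : ℝ) (x : Fin 2 → ℝ) : nrm (fun i => c * x i) = |c| * nrm x := by
  simp only [nrm]
  rw [← Real.sqrt_sq_eq_abs, ← Real.sqrt_mul (sq_nonneg c)]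
  congr 1
  ring

/-- Vectors on the first nonnegative half-axis have norm equal to their coordinate. -/
lemma nrm_axis {t : ℝ} (ht : 0 ≤ t) : nrm ![t, 0] = t := by
  simp [nrm, Real.sqrt_sq ht]

/-- The example drift coefficient b is not of linear growth. -/
theorem stmt12 (p K₀ : ℝ) (hp2 : 2 < p) (hp4 : p < 4) (hK₀ : 4 ≤ K₀)
    (K : ℝ) (hK : 0 < K) :
    ∃ x : Fin 2 → ℝ, K * (nrm x + 1) < nrm (bdrift p K₀ x) := by
  obtain ⟨t, htK, ht⟩ := (((tendsto_rpow_atTop (sub_pos.2 hp2)).eventually_ge_atTop K).and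
    (Filter.eventually_ge_atTop (1 : ℝ))).exists
  refine ⟨![t, 0], ?_⟩
  have hb : K₀ * (1 + K) ≤ K₀ * (1 + t ^ (p - 2)) := by gcongr
  have hpos : 0 < K₀ * (1 + K) := by positivity
  rw [show bdrift p K₀ ![t, 0] =
      fun i => -(K₀ * (1 + nrm ![t, 0] ^ (p - 2))) * ![t, 0] i from rfl,
    nrm_mul, nrm_axis (by linarith), abs_neg, abs_of_pos (hpos.trans_le hb)]
  calc K * (t + 1) < 4 * (1 + K) * t := by nlinarith
    _ ≤ K₀ * (1 + K) * t := by gcongr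
    _ ≤ K₀ * (1 + t ^ (p - 2)) * t := by gcongr
end
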